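/- arXiv:2202.08903 — 4 statements merged into one kernel-verified Lean document; each statement's English description precedes it below -/
import Mathlib

section
/- Let μ be an allocation, and let i ≠ j be indices with μ_j − 1 > a_j. If δ_j(μ_j − 1) < δ_i(μ_i), then the modified vector μ' defined by μ'_j = μ_j − 1, μ'_i = μ_i + 1, and μ'_k = μ_k for all k ∉ {i, j} is again an allocation, has the same total as μ, and has strictly smaller delay: Σ_k D_k(μ'_k) < Σ_k D_k(μ_k). -/
open Finset

/-- Computational delay of a VM with load parameter `a` and work parameter `c`
under a CPU allocation of `μ` units: `D(μ) = c / (μ - a)`. -/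
noncomputable def Dd (a c : ℝ) (μ : ℕ) : ℝ := c / ((μ : ℝ) - a)

/-- Delay-reduction function `δ(μ) = D(μ) - D(μ+1)`. -/
noncomputable def deltad (a c : ℝ) (μ : ℕ) : ℝ := Dd a c μ - Dd a c (μ + 1)

/-- An allocation is a vector `μ : Fin h → ℕ` with `μ k > a k` for every `k`. -/
def IsAlloc {h : ℕ} (a : Fin h → ℝ) (μ : Fin h → ℕ) : Prop := ∀ k, a k < (μ k : ℝ)

/-- The (total computational) delay of an allocation: `Σ_k D_k(μ_k)`. -/
noncomputable def delay {h : ℕ} (a c : Fin h → ℝ) (μ : Fin h → ℕ) : ℝ :=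
  ∑ k, Dd (a k) (c k) (μ k)

/-- `μ*` is `B`-minimal if its total equals `B` and its delay is less than or equal to
the delay of every allocation whose total equals `B`. -/
def BMinimal {h : ℕ} (a c : Fin h → ℝ) (B : ℕ) (μstar : Fin h → ℕ) : Prop :=
  IsAlloc a μstar ∧ (∑ k, μstar k) = B ∧
    ∀ ν : Fin h → ℕ, IsAlloc a ν → (∑ k, ν k) = B → delay a c μstar ≤ delay a c ν

/-- The initial allocation of the greedy process: `μ⁰_k = ⌊a_k⌋ + 1`. -/
noncomputable def initAlloc {h : ℕ} (a : Fin h → ℝ) : Fin h → ℕ := fun k => ⌊a k⌋₊ + 1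

/-- A greedy step from `μ` to `μ'` chooses an index `k*` maximizing the delay reduction
`δ_k(μ_k)` and increments the allocation of `k*` by one CPU unit. -/
def GreedyStep {h : ℕ} (a c : Fin h → ℝ) (μ μ' : Fin h → ℕ) : Prop :=
  ∃ kstar : Fin h,
    (∀ k, deltad (a k) (c k) (μ k) ≤ deltad (a kstar) (c kstar) (μ kstar)) ∧
    μ' = Function.update μ kstar (μ kstar + 1)

/-- An allocation is reachable if it is obtained from the initial allocation `μ⁰`
by a finite sequence of greedy steps. -/
def Reachable {h : ℕ} (a c : Fin h → ℝ) (μ : Fin h → ℕ) : Prop :=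
  Relation.ReflTransGen (GreedyStep a c) (initAlloc a) μ

/-- Changing one coordinate of `μ` changes a separable sum only in the corresponding term. -/
theorem sum_update_add {ι M : Type*} [Fintype ι] [DecidableEq ι] [AddCommMonoid M]
    {β : ι → Type*} (F : ∀ k, β k → M) (μ : ∀ k, β k) (i : ι) (y : β i) :
    ∑ k, F k (Function.update μ i y k) + F i (μ i) = ∑ k, F k (μ k) + F i y := by
  rw [← Finset.add_sum_erase _ _ (Finset.mem_univ i),
    ← Finset.add_sum_erase _ (fun k => F k (μ k)) (Finset.mem_univ i),
    Finset.sum_congr rfl fun k hk => by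
      rw [Function.update_of_ne (Finset.ne_of_mem_erase hk)]]
  simp only [Function.update_self]
  ac_rfl

/-- Let `μ` be an allocation, and let `i ≠ j` be indices with `μ_j − 1 > a_j`.
If `δ_j(μ_j − 1) < δ_i(μ_i)`, then the modified vector `μ'` with `μ'_j = μ_j − 1`,
`μ'_i = μ_i + 1`, and `μ'_k = μ_k` elsewhere is again an allocation, has the same total
as `μ`, and has strictly smaller delay. -/
theorem swap_decreases_delay {h : ℕ} (hh : 1 ≤ h) (a c : Fin h → ℝ)
    (ha : ∀ k, 0 ≤ a k) (hc : ∀ k, 0 < c k)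
    (μ : Fin h → ℕ) (hμ : IsAlloc a μ)
    (i j : Fin h) (hij : i ≠ j)
    (hj : a j < (μ j : ℝ) - 1)
    (hlt : deltad (a j) (c j) (μ j - 1) < deltad (a i) (c i) (μ i)) :
    IsAlloc a (Function.update (Function.update μ j (μ j - 1)) i (μ i + 1)) ∧
    (∑ k, (Function.update (Function.update μ j (μ j - 1)) i (μ i + 1)) k) = (∑ k, μ k) ∧
    delay a c (Function.update (Function.update μ j (μ j - 1)) i (μ i + 1))
      < delay a c μ := by
  have hpos : 1 ≤ μ j := by
    have : (0 : ℝ) < μ j := by linarith [ha j]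
    exact_mod_cast this
  refine ⟨fun k => ?_, ?_, ?_⟩
  · rcases eq_or_ne k i with rfl | hki
    · rw [Function.update_self]
      push_cast
      linarith [hμ k]
    · rw [Function.update_of_ne hki]
      rcases eq_or_ne k j with rfl | hkj
      · rw [Function.update_self]
        push_cast [hpos]
        exact hj
      · rw [Function.update_of_ne hkj]
        exact hμ k
  · have hi := sum_update_add (fun _ n => n) (Function.update μ j (μ j - 1)) i (μ i + 1)
    have hj' := sum_update_add (fun _ n => n) μ j (μ j - 1)
    simp only [Function.update_of_ne hij] at hi
    omega
  · have hi := sum_update_add (fun k => Dd (a k) (c k))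
      (Function.update μ j (μ j - 1)) i (μ i + 1)
    have hj' := sum_update_add (fun k => Dd (a k) (c k)) μ j (μ j - 1)
    rw [Function.update_of_ne hij] at hi
    unfold deltad at hlt
    rw [Nat.sub_add_cancel hpos] at hlt
    unfold delay
    linarith
end

section
/- Let B be a natural number and let μ* be a B-minimal allocation. Then for any two indices i, j ∈ {1, …, h} with μ*_j − 1 > a_j, it holds that δ_j(μ*_j − 1) ≥ δ_i(μ*_i). -/
open Finset

theorem sum_apply_update {ι M : Type*} {β : ι → Type*} [Fintype ι] [DecidableEq ι]
    [AddCommGroup M] (f : ∀ k, β k → M) (μ : ∀ k, β k) (i : ι) (v : β i) :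
    ∑ k, f k (Function.update μ i v k) = ∑ k, f k (μ k) + (f i v - f i (μ i)) := by
  rw [← sub_eq_iff_eq_add', ← Finset.sum_sub_distrib, Fintype.sum_eq_single i]
  · simp
  · intro k hk
    simp [hk]

/-- The delay reduction is nonincreasing in the CPU amount. -/
theorem deltad_succ_le {a c : ℝ} (hc : 0 ≤ c) {m : ℕ} (hm : a < m) :
    deltad a c (m + 1) ≤ deltad a c m := by
  have key : ∀ x : ℝ, 0 < x → c / (x + 1) - c / (x + 2) ≤ c / x - c / (x + 1) := by
    intro x hx
    have h : c / x - c / (x + 1) - (c / (x + 1) - c / (x + 2)) =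
        2 * c / (x * (x + 1) * (x + 2)) := by
      field_simp
      ring
    have : 0 ≤ 2 * c / (x * (x + 1) * (x + 2)) := by positivity
    linarith
  convert key (m - a) (sub_pos.mpr hm) using 1 <;>
    (simp only [deltad, Dd]; push_cast; ring_nf)

/-- Let `B` be a natural number and let `μ*` be a `B`-minimal allocation.
Then for any two indices `i, j` with `μ*_j − 1 > a_j`, it holds that
`δ_j(μ*_j − 1) ≥ δ_i(μ*_i)`. -/
theorem bminimal_delta_ineq {h : ℕ} (hh : 1 ≤ h) (a c : Fin h → ℝ)
    (ha : ∀ k, 0 ≤ a k) (hc : ∀ k, 0 < c k)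
    (B : ℕ) (μstar : Fin h → ℕ) (hmin : BMinimal a c B μstar)
    (i j : Fin h) (hj : a j < (μstar j : ℝ) - 1) :
    deltad (a i) (c i) (μstar i) ≤ deltad (a j) (c j) (μstar j - 1) := by
  obtain ⟨halloc, hsum, hle⟩ := hmin
  obtain ⟨m, hm⟩ : ∃ m, μstar j = m + 1 := by
    refine Nat.exists_eq_succ_of_ne_zero fun h0 => ?_
    have := ha j
    rw [h0] at hj
    norm_num at hj
    linarith
  have hjm : a j < m := by
    rw [hm] at hj
    simpa using hj
  rcases eq_or_ne i j with rfl | hij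
  · rw [hm, Nat.add_sub_cancel]
    exact deltad_succ_le (hc i).le hjm
  -- Moving one CPU unit from `j` to `i` yields another allocation of the same total.
  set ν : Fin h → ℕ := Function.update (Function.update μstar i (μstar i + 1)) j m with hν
  have hνalloc : IsAlloc a ν := by
    intro k
    rcases eq_or_ne k j with rfl | hkj
    · simpa [hν] using hjm
    rcases eq_or_ne k i with rfl | hki
    · have := halloc k
      simp only [hν, Function.update_of_ne hkj, Function.update_self]
      push_cast
      linarith
    · simpa [hν, hkj, hki] using halloc k
  have hνsum : ∑ k, ν k = B := by
    have h₁ := sum_apply_update (fun _ (n : ℕ) => (n : ℤ)) μstar i (μstar i + 1)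
    have h₂ := sum_apply_update (fun _ (n : ℕ) => (n : ℤ))
      (Function.update μstar i (μstar i + 1)) j m
    rw [Function.update_of_ne hij.symm, hm] at h₂
    rw [← hsum]
    zify
    rw [hν, h₂, h₁]
    push_cast
    ring
  have hdelay := hle ν hνalloc hνsum
  simp only [delay, hν] at hdelay
  rw [sum_apply_update (fun k => Dd (a k) (c k)), sum_apply_update (fun k => Dd (a k) (c k)),
    Function.update_of_ne hij.symm, hm] at hdelay
  rw [hm, Nat.add_sub_cancel]
  simp only [deltad]
  linarith
end

section
/- Let i, j ∈ {1, …, h} and let p, q be natural numbers with p > a_j and q > a_i such that δ_j(p) > δ_i(q). Then every allocation μ reachable by the greedy process satisfies: if μ_i ≥ q + 1, then μ_j ≥ p + 1. (That is, the greedy process never assigns more than q CPU units to index i before it has assigned at least p + 1 CPU units to index j.) -/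
open Finset

theorem deltad_eq {a c : ℝ} {m : ℕ} (hm : a < m) :
    deltad a c m = c / (((m : ℝ) - a) * ((m : ℝ) + 1 - a)) := by
  have h₁ : (m : ℝ) - a ≠ 0 := by linarith
  have h₂ : (m : ℝ) + 1 - a ≠ 0 := by linarith
  simp only [deltad, Dd, Nat.cast_add, Nat.cast_one]
  field_simp
  ring

theorem deltad_le_of_le {a c : ℝ} (hc : 0 ≤ c) {m n : ℕ} (hm : a < m) (hmn : m ≤ n) :
    deltad a c n ≤ deltad a c m := by
  have hmn' : (m : ℝ) ≤ n := by exact_mod_cast hmn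
  have h₁ : 0 < (m : ℝ) - a := by linarith
  have h₂ : 0 < (m : ℝ) + 1 - a := by linarith
  rw [deltad_eq hm, deltad_eq (hm.trans_le hmn')]
  gcongr
  linarith

theorem isAlloc_initAlloc {h : ℕ} (a : Fin h → ℝ) : IsAlloc a (initAlloc a) := fun k => by
  simpa [initAlloc] using Nat.lt_floor_add_one (a k)

theorem GreedyStep.le {h : ℕ} {a c : Fin h → ℝ} {μ μ' : Fin h → ℕ}
    (hstep : GreedyStep a c μ μ') : μ ≤ μ' := by
  obtain ⟨k, -, rfl⟩ := hstep
  exact le_update_self_iff.2 (Nat.le_succ _)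

theorem Reachable.isAlloc {h : ℕ} {a c : Fin h → ℝ} {μ : Fin h → ℕ}
    (hμ : Reachable a c μ) : IsAlloc a μ := by
  induction hμ with
  | refl => exact isAlloc_initAlloc a
  | tail _ hstep ih => exact fun k => (ih k).trans_le (by exact_mod_cast hstep.le k)

/-- Let `i, j` be indices and `p, q` naturals with `p > a_j`, `q > a_i` and
`δ_j(p) > δ_i(q)`. Then every allocation `μ` reachable by the greedy process satisfies:
if `μ_i ≥ q + 1`, then `μ_j ≥ p + 1`. -/
theorem greedy_never_picks_smaller {h : ℕ} (hh : 1 ≤ h) (a c : Fin h → ℝ)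
    (ha : ∀ k, 0 ≤ a k) (hc : ∀ k, 0 < c k)
    (i j : Fin h) (p q : ℕ) (hp : a j < (p : ℝ)) (hq : a i < (q : ℝ))
    (hδ : deltad (a i) (c i) q < deltad (a j) (c j) p)
    (μ : Fin h → ℕ) (hμ : Reachable a c μ)
    (hi : q + 1 ≤ μ i) : p + 1 ≤ μ j := by
  induction hμ with
  | refl =>
    have : ⌊a i⌋₊ < q := (Nat.floor_lt (ha i)).2 hq
    simp only [initAlloc] at hi
    omega
  | @tail ν ν' hν hstep ih =>
    by_cases hqi : q + 1 ≤ ν i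
    · exact (ih hqi).trans (hstep.le j)
    · refine le_trans ?_ (hstep.le j)
      obtain ⟨k, hmax, rfl⟩ := hstep
      have hki : i = k := by
        by_contra hne
        exact hqi (by simpa [Function.update_of_ne hne] using hi)
      subst hki
      have hνi : ν i = q := by
        simp only [Function.update_self] at hi
        omega
      by_contra! hlt
      have hδj := deltad_le_of_le (hc j).le (Reachable.isAlloc hν j) (Nat.lt_succ_iff.1 hlt)
      have hδi := hmax j
      rw [hνi] at hδi
      linarith
end

section
/- Let k ≥ 1 and let n : {1, …, k} → ℕ satisfy n_i ≥ 2 for all i, and suppose Σ_{i=1}^k n_i = 2C for a natural number C. Then the following are equivalent: (1) there exists a subset N ⊆ {1, …, k} with Σ_{i ∈ N} n_i = C; (2) there exist functions y : {1, …, k} → {0, 1} (placement on one of two datacenters of capacity C each) and μ : {1, …, k} → ℕ (CPU allocations) such that for every i, μ_i ≥ 2 and 1/((μ_i : ℝ) − 1) ≤ 1/((n_i : ℝ) − 1), and the capacity constraints Σ_{i : y(i) = 0} μ_i ≤ C and Σ_{i : y(i) = 1} μ_i ≤ C both hold. -/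
open Finset

theorem sum_filter_eq_zero_add_sum_filter_eq_one {ι M : Type*} [Fintype ι] [AddCommMonoid M]
    (y : ι → Fin 2) (f : ι → M) :
    (∑ i ∈ univ.filter (fun i => y i = 0), f i) + (∑ i ∈ univ.filter (fun i => y i = 1), f i) =
      ∑ i, f i := by
  rw [← sum_fiberwise univ y f, Fin.sum_univ_two]

/-- Meeting the target delay `1 / (n - 1)` requires at least `n` CPU units. -/
theorem le_of_one_div_sub_one_le {m n : ℕ} (hm : 2 ≤ m) (hn : 2 ≤ n)
    (h : 1 / ((m : ℝ) - 1) ≤ 1 / ((n : ℝ) - 1)) : n ≤ m := by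
  have hm' : (2 : ℝ) ≤ m := by exact_mod_cast hm
  have hn' : (2 : ℝ) ≤ n := by exact_mod_cast hn
  have := (one_div_le_one_div (by linarith) (by linarith)).mp h
  exact_mod_cast (sub_le_sub_iff_right (1 : ℝ)).mp this

/-- Correctness of the reduction from the partition problem. Let `k ≥ 1`,
`n : Fin k → ℕ` with `n i ≥ 2` for all `i`, and `Σ_i n i = 2·C`. Then there exists a
subset `N` with `Σ_{i ∈ N} n i = C` iff there exist a placement `y : Fin k → Fin 2` on
two datacenters of capacity `C` each, and CPU allocations `μ : Fin k → ℕ` with `μ i ≥ 2`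
and `1/(μ i − 1) ≤ 1/(n i − 1)` (delay constraint) for all `i`, respecting both capacity
constraints. -/
theorem partition_reduction_correct (k : ℕ) (hk : 1 ≤ k)
    (n : Fin k → ℕ) (hn : ∀ i, 2 ≤ n i)
    (C : ℕ) (hsum : (∑ i, n i) = 2 * C) :
    (∃ N : Finset (Fin k), (∑ i ∈ N, n i) = C) ↔
    (∃ (y : Fin k → Fin 2) (μ : Fin k → ℕ),
      (∀ i, 2 ≤ μ i) ∧
      (∀ i, 1 / ((μ i : ℝ) - 1) ≤ 1 / ((n i : ℝ) - 1)) ∧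
      (∑ i ∈ univ.filter (fun i => y i = 0), μ i) ≤ C ∧
      (∑ i ∈ univ.filter (fun i => y i = 1), μ i) ≤ C) := by
  constructor
  · rintro ⟨N, hN⟩
    have h₀ : univ.filter (fun i => (if i ∈ N then 0 else 1 : Fin 2) = 0) = N := by
      ext i
      by_cases hi : i ∈ N <;> simp [hi]
    have hsplit := sum_filter_eq_zero_add_sum_filter_eq_one
      (fun i => if i ∈ N then 0 else 1) n
    rw [h₀] at hsplit
    refine ⟨fun i => if i ∈ N then 0 else 1, n, hn, fun _ => le_rfl, ?_, ?_⟩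
    · rw [h₀, hN]
    · beta_reduce
      omega
  · rintro ⟨y, μ, hμ, hdelay, hcap₀, hcap₁⟩
    have hle : ∀ i, n i ≤ μ i := fun i => le_of_one_div_sub_one_le (hμ i) (hn i) (hdelay i)
    have hle₀ := (sum_le_sum fun i _ => hle i).trans hcap₀
    have hle₁ := (sum_le_sum fun i _ => hle i).trans hcap₁
    have hsplit := sum_filter_eq_zero_add_sum_filter_eq_one y n
    exact ⟨univ.filter (fun i => y i = 0), by omega⟩
end
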